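/- Fix a positive rational number γ and let z_γ ∈ (0,1) be the unique solution of l_γ'(z) = 0. Then, as d → ∞ along positive integers d such that γd is an integer, the ratio N₁(d,γ) / N₂(d,γ) converges to h(z_γ). -/

import Mathlib

open Real Set Filter

/-- The Jacobi theta function `h(z) = Σ_{r ∈ ℤ} z^{r²}` for real `0 < z < 1`. -/
noncomputable def jacobiH (z : ℝ) : ℝ := ∑' r : ℤ, z ^ (r ^ 2).toNat

/-- `l_γ(z) = log h(z) − γ log z`. -/
noncomputable def lgam (γ : ℝ) (z : ℝ) : ℝ := Real.log (jacobiH z) - γ * Real.log z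

/-- `N₁(d,γ) = #{k ∈ ℤ^d : k₁² + … + k_d² ≤ γ d}`. -/
noncomputable def N1 (d : ℕ) (γ : ℝ) : ℕ :=
  Set.ncard {k : Fin d → ℤ | (∑ i, ((k i : ℝ)) ^ 2) ≤ γ * d}

/-- The filter of `d → ∞` along positive integers `d` such that `γ d` is an integer. -/
def alongIntMultiples (γ : ℚ) : Filter ℕ :=
  Filter.atTop ⊓ Filter.principal {d : ℕ | ∃ m : ℤ, (γ : ℝ) * d = (m : ℝ)}

/-- `N₂(d,γ) = #{k ∈ ℤ^d : k₁ = 0 and k₂² + … + k_d² ≤ γ d}` (the first coordinate,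
i.e. the coordinate of index `0`, vanishes). -/
noncomputable def N2 (d : ℕ) (γ : ℝ) : ℕ :=
  Set.ncard {k : Fin d → ℤ |
    (∀ i : Fin d, (i : ℕ) = 0 → k i = 0) ∧ (∑ i, ((k i : ℝ)) ^ 2) ≤ γ * d}

/-- The trigonometric series `Σ p_r e^{i x_r θ}` with weights `p` and frequencies `x`. -/
noncomputable def trigSeries {ι : Type*} (p x : ι → ℝ) (θ : ℝ) : ℂ :=
  ∑' r, (p r : ℂ) * Complex.exp ((x r * θ : ℝ) * Complex.I)

lemma norm_weight_mul_exp {a : ℝ} (ha : 0 ≤ a) (y : ℝ) :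
    ‖(a : ℂ) * Complex.exp ((y : ℝ) * Complex.I)‖ = a := by
  rw [norm_mul, Complex.norm_exp_ofReal_mul_I, mul_one, Complex.norm_of_nonneg ha]

lemma summable_weight_mul_exp {ι : Type*} {p : ι → ℝ} (hp : ∀ r, 0 ≤ p r) (hs : Summable p)
    (y : ι → ℝ) : Summable fun r => (p r : ℂ) * Complex.exp ((y r : ℝ) * Complex.I) :=
  Summable.of_norm (by simpa only [norm_weight_mul_exp (hp _)] using hs)

lemma continuous_trigSeries {ι : Type*} {p : ι → ℝ} (hp : ∀ r, 0 ≤ p r) (hs : Summable p)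
    (x : ι → ℝ) : Continuous (trigSeries p x) :=
  continuous_tsum (fun r => by fun_prop) hs fun r θ => (norm_weight_mul_exp (hp r) _).le

lemma norm_exp_mul_I_sub_one_sub_le (v : ℝ) :
    ‖Complex.exp (v * Complex.I) - 1 - v * Complex.I‖ ≤ 3 * v ^ 2 := by
  have hn : ‖(v : ℂ) * Complex.I‖ = |v| := by simp
  rcases le_total |v| 1 with h | h
  · have := Complex.norm_exp_sub_one_sub_id_le (x := v * Complex.I) (by rwa [hn])
    rw [hn, sq_abs] at this
    nlinarith [sq_nonneg v]
  · have h1 : ‖Complex.exp (v * Complex.I) - 1 - v * Complex.I‖ ≤ 1 + 1 + |v| := by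
      refine (norm_sub_le _ _).trans (add_le_add ((norm_sub_le _ _).trans ?_) hn.le)
      simp [Complex.norm_exp_ofReal_mul_I]
    nlinarith [sq_abs v]

lemma tendsto_nat_mul_exp_sub_one_sub (v : ℝ) :
    Tendsto (fun n : ℕ => (n : ℂ) * (Complex.exp ((v / √n : ℝ) * Complex.I) - 1
      - (v / √n : ℝ) * Complex.I)) atTop (nhds ((-(v ^ 2 / 2) : ℝ) : ℂ)) := by
  have hlim : Tendsto (fun n : ℕ => |v| / √n) atTop (nhds 0) :=
    tendsto_const_nhds.div_atTop (tendsto_sqrt_atTop.comp tendsto_natCast_atTop_atTop)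
  have hbound : Tendsto (fun n : ℕ => v ^ 2 * ((|v| / √n) * rexp (|v| / √n))) atTop (nhds 0) := by
    have := (hlim.mul ((Real.continuous_exp.tendsto 0).comp hlim)).const_mul (v ^ 2)
    simpa using this
  rw [tendsto_iff_norm_sub_tendsto_zero]
  refine squeeze_zero' (Eventually.of_forall fun _ => norm_nonneg _) ?_ hbound
  filter_upwards [eventually_gt_atTop 0] with n hn
  have hn' : (0 : ℝ) < n := by exact_mod_cast hn
  have hsq : √(n : ℝ) ^ 2 = n := Real.sq_sqrt hn'.le
  have hs : 0 < √(n : ℝ) := Real.sqrt_pos.2 hn'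
  have hnx : ‖((v / √n : ℝ) : ℂ) * Complex.I‖ = |v| / √n := by
    rw [norm_mul, Complex.norm_I, mul_one, Complex.norm_real, Real.norm_eq_abs, abs_div,
      abs_of_pos hs]
  have key := Complex.norm_exp_sub_sum_le_norm_mul_exp (((v / √n : ℝ) : ℂ) * Complex.I) 3
  rw [hnx] at key
  have hnv : (n : ℝ) * (v / √n) ^ 2 = v ^ 2 := by
    rw [div_pow, hsq]; field_simp
  have hnv' : (n : ℂ) * ((v / √n : ℝ) : ℂ) ^ 2 = (v : ℂ) ^ 2 := by exact_mod_cast hnv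
  have hrew : (n : ℂ) * (Complex.exp ((v / √n : ℝ) * Complex.I) - 1
      - (v / √n : ℝ) * Complex.I) - ((-(v ^ 2 / 2) : ℝ) : ℂ)
      = n * (Complex.exp (((v / √n : ℝ) : ℂ) * Complex.I)
        - ∑ m ∈ Finset.range 3, (((v / √n : ℝ) : ℂ) * Complex.I) ^ m / (m.factorial : ℂ)) := by
    simp only [Finset.sum_range_succ, Finset.sum_range_zero, mul_pow, Complex.I_sq]
    push_cast [Nat.factorial] at hnv' ⊢
    linear_combination (-1 / 2 : ℂ) * hnv'
  rw [hrew, norm_mul, Complex.norm_natCast]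
  calc (n : ℝ) * _ ≤ n * ((|v| / √n) ^ 3 * rexp (|v| / √n)) := by gcongr
    _ = (n * (v / √n) ^ 2) * ((|v| / √n) * rexp (|v| / √n)) := by
        rw [div_pow v, ← sq_abs v, ← div_pow]; ring
    _ = _ := by rw [hnv]

/-- The central limit theorem for characteristic functions of a centred discrete law. -/
lemma tendsto_trigSeries_div_sqrt_pow {ι : Type*} {p x : ι → ℝ} (hp : ∀ r, 0 ≤ p r)
    (h0 : HasSum p 1) (h1 : HasSum (fun r => p r * x r) 0)
    (h2 : Summable fun r => p r * x r ^ 2) (u : ℝ) :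
    Tendsto (fun n : ℕ => trigSeries p x (u / √n) ^ n) atTop
      (nhds (Complex.exp ((-((∑' r, p r * x r ^ 2) / 2) * u ^ 2 : ℝ)))) := by
  have hsum : ∀ θ : ℝ, HasSum (fun r => (p r : ℂ) * (Complex.exp ((x r * θ : ℝ) * Complex.I) - 1
      - (x r * θ : ℝ) * Complex.I)) (trigSeries p x θ - 1) := by
    intro θ
    have e0 : HasSum (fun r => (p r : ℂ)) 1 := by
      simpa using Complex.hasSum_ofReal.2 h0
    have e1 : HasSum (fun r => ((p r * x r : ℝ) : ℂ)) 0 := by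
      simpa using (Complex.hasSum_ofReal.2 h1)
    have e := (((summable_weight_mul_exp hp h0.summable fun r => x r * θ).hasSum).sub e0).sub
      (e1.mul_right ((θ : ℂ) * Complex.I))
    rw [zero_mul, sub_zero] at e
    convert! e using 2
    push_cast
    ring
  have hlim : Tendsto (fun n : ℕ => (n : ℂ) * (trigSeries p x (u / √n) - 1)) atTop
      (nhds ((-((∑' r, p r * x r ^ 2) / 2) * u ^ 2 : ℝ) : ℂ)) := by
    have heq : ∀ n : ℕ, (n : ℂ) * (trigSeries p x (u / √n) - 1)
        = ∑' r, (p r : ℂ) * (n * (Complex.exp ((x r * u / √n : ℝ) * Complex.I) - 1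
          - (x r * u / √n : ℝ) * Complex.I)) := by
      intro n
      rw [← ((hsum (u / √n)).mul_left (n : ℂ)).tsum_eq]
      refine tsum_congr fun r => ?_
      rw [mul_div_assoc]; ring
    have htgt : ((-((∑' r, p r * x r ^ 2) / 2) * u ^ 2 : ℝ) : ℂ)
        = ∑' r, (p r : ℂ) * ((-((x r * u) ^ 2 / 2) : ℝ) : ℂ) := by
      have : (-((∑' r, p r * x r ^ 2) / 2) * u ^ 2 : ℝ)
          = ∑' r, p r * (-((x r * u) ^ 2 / 2)) := by
        rw [show -((∑' r, p r * x r ^ 2) / 2) * u ^ 2 = (∑' r, p r * x r ^ 2) * (-(u ^ 2 / 2)) by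
          ring, ← tsum_mul_right]
        exact tsum_congr fun r => by ring
      rw [this, Complex.ofReal_tsum]
      exact tsum_congr fun r => by push_cast; ring
    simp_rw [heq]
    rw [htgt]
    refine tendsto_tsum_of_dominated_convergence
      (bound := fun r => p r * x r ^ 2 * (3 * u ^ 2)) (h2.mul_right _)
      (fun r => (tendsto_nat_mul_exp_sub_one_sub (x r * u)).const_mul _) ?_
    filter_upwards [eventually_gt_atTop 0] with n hn r
    have hn' : (0 : ℝ) < n := by exact_mod_cast hn
    rw [norm_mul, norm_mul, Complex.norm_natCast, Complex.norm_of_nonneg (hp r)]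
    calc p r * (n * _) ≤ p r * (n * (3 * (x r * u / √n) ^ 2)) := by
          have := hp r
          gcongr
          exact norm_exp_mul_I_sub_one_sub_le _
      _ = _ := by
          rw [div_pow, Real.sq_sqrt hn'.le]; field_simp
  have := Complex.tendsto_one_add_pow_exp_of_tendsto hlim
  simpa using this

/-- Laplace's method for powers of a characteristic function. -/
lemma tendsto_sqrt_mul_integral_trigSeries_pow {ι : Type*} {p x : ι → ℝ} (hp : ∀ r, 0 ≤ p r)
    (h0 : HasSum p 1) (h1 : HasSum (fun r => p r * x r) 0)
    (h2 : Summable fun r => p r * x r ^ 2) {c : ℝ} (hc : 0 < c)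
    (hbound : ∀ θ : ℝ, |θ| ≤ π → ‖trigSeries p x θ‖ ≤ rexp (-c * θ ^ 2))
    {F : ℝ → ℂ} (hF : Continuous F) :
    Tendsto (fun n : ℕ => ((√n : ℝ) : ℂ) * ∫ θ in (-π)..π, trigSeries p x θ ^ n * F θ) atTop
      (nhds ((∫ u : ℝ, Complex.exp ((-((∑' r, p r * x r ^ 2) / 2) * u ^ 2 : ℝ))) * F 0)) := by
  have hψ := continuous_trigSeries hp h0.summable x
  obtain ⟨M, hM⟩ := isCompact_Icc.exists_bound_of_continuousOn (s := Icc (-π) π) hF.continuousOn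
  have hM0 : 0 ≤ M := (norm_nonneg _).trans (hM 0 ⟨by linarith [pi_pos], pi_pos.le⟩)
  have hcov : ∀ n : ℕ, 0 < n → ((√n : ℝ) : ℂ) * ∫ θ in (-π)..π, trigSeries p x θ ^ n * F θ
      = ∫ u : ℝ, (Ioc (-π * √n) (π * √n)).indicator
        (fun u => trigSeries p x (u / √n) ^ n * F (u / √n)) u := by
    intro n hn
    have hs : 0 < √(n : ℝ) := Real.sqrt_pos.2 (by exact_mod_cast hn)
    rw [MeasureTheory.integral_indicator measurableSet_Ioc,
      ← intervalIntegral.integral_of_le (by nlinarith [pi_pos]),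
      intervalIntegral.integral_comp_div (fun θ => trigSeries p x θ ^ n * F θ) hs.ne',
      mul_div_cancel_right₀ _ hs.ne', mul_div_cancel_right₀ _ hs.ne', Complex.real_smul]
  rw [← MeasureTheory.integral_mul_const]
  refine Tendsto.congr' (f₁ := fun n : ℕ => ∫ u : ℝ, (Ioc (-π * √n) (π * √n)).indicator
        (fun u => trigSeries p x (u / √n) ^ n * F (u / √n)) u) ?_ ?_
  · filter_upwards [eventually_gt_atTop 0] with n hn using (hcov n hn).symm
  refine MeasureTheory.tendsto_integral_filter_of_dominated_convergence
    (fun u => rexp (-c * u ^ 2) * M) ?_ ?_ ((integrable_exp_neg_mul_sq hc).mul_const _) ?_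
  · refine Eventually.of_forall fun n => ?_
    refine (Continuous.aestronglyMeasurable ?_).indicator measurableSet_Ioc
    fun_prop
  · filter_upwards [eventually_gt_atTop 0] with n hn
    refine Eventually.of_forall fun u => ?_
    have hn' : (0 : ℝ) < n := by exact_mod_cast hn
    have hs : 0 < √(n : ℝ) := Real.sqrt_pos.2 hn'
    by_cases hu : u ∈ Ioc (-π * √n) (π * √n)
    · rw [indicator_of_mem hu, norm_mul, norm_pow]
      have hle : u / √n ∈ Icc (-π) π :=
        ⟨by rw [le_div_iff₀ hs]; exact hu.1.le, by rw [div_le_iff₀ hs]; exact hu.2⟩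
      have hb := hbound (u / √n) (abs_le.2 hle)
      calc _ ≤ rexp (-c * (u / √n) ^ 2) ^ n * M := by gcongr; exact hM _ hle
        _ = _ := by
          rw [← Real.exp_nat_mul, div_pow, Real.sq_sqrt hn'.le]
          congr 2; field_simp
    · rw [indicator_of_notMem hu, norm_zero]; positivity
  · refine Eventually.of_forall fun u => ?_
    have hsq : Tendsto (fun n : ℕ => √(n : ℝ)) atTop atTop :=
      tendsto_sqrt_atTop.comp tendsto_natCast_atTop_atTop
    have hF0 : Tendsto (fun n : ℕ => F (u / √n)) atTop (nhds (F 0)) :=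
      (hF.tendsto 0).comp (tendsto_const_nhds.div_atTop hsq)
    refine Tendsto.congr' ?_ ((tendsto_trigSeries_div_sqrt_pow hp h0 h1 h2 u).mul hF0)
    filter_upwards [(hsq.const_mul_atTop pi_pos).eventually_gt_atTop |u|] with n hn
    rw [indicator_of_mem]
    rw [abs_lt] at hn
    exact ⟨by linarith [hn.1], hn.2.le⟩

/-- Two frequencies differing by one force Gaussian decay of the characteristic function. -/
lemma exists_norm_trigSeries_le_exp {ι : Type*} {p x : ι → ℝ} (hp : ∀ r, 0 ≤ p r)
    (h0 : HasSum p 1) {r₀ r₁ : ι} (hpos₀ : 0 < p r₀) (hpos₁ : 0 < p r₁)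
    (hx : x r₁ = x r₀ + 1) :
    ∃ c : ℝ, 0 < c ∧ ∀ θ : ℝ, |θ| ≤ π → ‖trigSeries p x θ‖ ≤ rexp (-c * θ ^ 2) := by
  classical
  set a := p r₀ with ha
  set b := p r₁ with hb
  have hne : r₀ ≠ r₁ := by rintro rfl; linarith
  have hπ := pi_pos
  refine ⟨2 * a * b / (π ^ 2 * (a + b)), by positivity, fun θ hθ => ?_⟩
  set D := 2 * a * b / (π ^ 2 * (a + b)) * θ ^ 2 with hD
  have hθ2 : θ ^ 2 ≤ π ^ 2 := sq_le_sq.2 (by rwa [abs_of_pos hπ])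
  have hDeq : D * (a + b) = 2 * a * b * (θ ^ 2 / π ^ 2) := by rw [hD]; field_simp
  have hDle : D ≤ a + b := by
    have h1 : θ ^ 2 / π ^ 2 ≤ 1 := div_le_one_of_le₀ hθ2 (by positivity)
    have h2 : D * (a + b) ≤ (a + b) * (a + b) := by
      rw [hDeq]
      nlinarith [mul_pos hpos₀ hpos₁, sq_nonneg a, sq_nonneg b]
    exact le_of_mul_le_mul_right h2 (by positivity)
  have hpair : ‖(a : ℂ) + b * Complex.exp (θ * Complex.I)‖ ≤ a + b - D := by
    refine abs_le_of_sq_le_sq' ?_ (by linarith) |>.2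
    have hcos := Real.cos_le_one_sub_mul_cos_sq hθ
    have hns : ‖(a : ℂ) + b * Complex.exp (θ * Complex.I)‖ ^ 2
        = a ^ 2 + b ^ 2 + 2 * a * b * Real.cos θ := by
      rw [← Complex.normSq_eq_norm_sq, Complex.exp_mul_I, ← Complex.ofReal_cos,
        ← Complex.ofReal_sin, Complex.normSq_apply]
      simp only [Complex.add_re, Complex.add_im, Complex.mul_re, Complex.mul_im, Complex.ofReal_re,
        Complex.ofReal_im, Complex.I_re, Complex.I_im]
      linear_combination b ^ 2 * Real.sin_sq_add_cos_sq θ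
    rw [hns]
    have h3 : 2 * a * b * Real.cos θ ≤ 2 * a * b * (1 - 2 / π ^ 2 * θ ^ 2) := by gcongr
    have h4 : 2 * a * b * (1 - 2 / π ^ 2 * θ ^ 2) = 2 * a * b - 2 * (D * (a + b)) := by
      rw [hDeq]; ring
    nlinarith [sq_nonneg D]
  have hs := summable_weight_mul_exp hp h0.summable fun r => x r * θ
  have hsplit := hs.sum_add_tsum_compl (s := {r₀, r₁})
  have hsplitp := h0.summable.sum_add_tsum_compl (s := {r₀, r₁})
  rw [h0.tsum_eq, Finset.sum_pair hne] at hsplitp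
  have hrest : ‖∑' r : ↑(({r₀, r₁} : Finset ι) : Set ι)ᶜ,
      (p r : ℂ) * Complex.exp ((x r * θ : ℝ) * Complex.I)‖ ≤ 1 - a - b := by
    have hsc : Summable fun r : ↑(({r₀, r₁} : Finset ι) : Set ι)ᶜ => p r := h0.summable.subtype _
    refine (tsum_of_norm_bounded hsc.hasSum fun r => (norm_weight_mul_exp (hp r) _).le).trans ?_
    linarith
  have hhead : ‖∑ r ∈ ({r₀, r₁} : Finset ι),
      (p r : ℂ) * Complex.exp ((x r * θ : ℝ) * Complex.I)‖ ≤ a + b - D := by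
    rw [Finset.sum_pair hne, hx]
    have : (p r₀ : ℂ) * Complex.exp ((x r₀ * θ : ℝ) * Complex.I)
        + p r₁ * Complex.exp (((x r₀ + 1) * θ : ℝ) * Complex.I)
        = Complex.exp ((x r₀ * θ : ℝ) * Complex.I) * (a + b * Complex.exp (θ * Complex.I)) := by
      rw [add_mul, one_mul, Complex.ofReal_add, add_mul, Complex.exp_add]
      ring
    rw [this, norm_mul, Complex.norm_exp_ofReal_mul_I, one_mul]
    exact hpair
  calc ‖trigSeries p x θ‖ ≤ (a + b - D) + (1 - a - b) := by
        rw [trigSeries, ← hsplit]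
        exact (norm_add_le _ _).trans (add_le_add hhead hrest)
    _ = -D + 1 := by ring
    _ ≤ rexp (-D) := Real.add_one_le_exp _
    _ = _ := by rw [hD, neg_mul]

lemma toNat_sq_eq_natAbs_sq (r : ℤ) : (r ^ 2).toNat = r.natAbs ^ 2 := by
  rw [← Int.natAbs_sq]
  exact_mod_cast Int.toNat_natCast (r.natAbs ^ 2)

lemma cast_toNat_sq {R : Type*} [Ring R] (r : ℤ) : ((r ^ 2).toNat : R) = (r : R) ^ 2 := by
  have : (((r ^ 2).toNat : ℤ) : R) = ((r ^ 2 : ℤ) : R) := by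
    rw [Int.toNat_of_nonneg (sq_nonneg r)]
  exact_mod_cast this

lemma summable_toNat_sq_pow_mul_pow {z : ℝ} (hz0 : 0 ≤ z) (hz1 : z < 1) (j : ℕ) :
    Summable fun r : ℤ => ((r ^ 2).toNat : ℝ) ^ j * z ^ (r ^ 2).toNat := by
  have h : Summable fun n : ℕ => ((n ^ 2 : ℕ) : ℝ) ^ j * z ^ (n ^ 2) := by
    refine Summable.of_nonneg_of_le (fun n => by positivity) (fun n => ?_)
      (summable_pow_mul_geometric_of_norm_lt_one (2 * j)
        (r := z) (by rwa [Real.norm_of_nonneg hz0]))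
    rw [Nat.cast_pow, ← pow_mul]
    have := pow_le_pow_of_le_one hz0 hz1.le (Nat.le_self_pow two_ne_zero n)
    gcongr
  simp_rw [toNat_sq_eq_natAbs_sq]
  exact Summable.of_nat_of_neg (by simpa using h) (by simpa using h)

lemma hasDerivAt_jacobiH {z : ℝ} (hz : z ∈ Ioo (0 : ℝ) 1) :
    HasDerivAt jacobiH (∑' r : ℤ, ((r ^ 2).toNat : ℝ) * z ^ ((r ^ 2).toNat - 1)) z := by
  obtain ⟨ρ, hzρ, hρ1⟩ := exists_between hz.2
  have hρ0 : 0 < ρ := hz.1.trans hzρ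
  have hu : Summable fun r : ℤ => ((r ^ 2).toNat : ℝ) * ρ ^ ((r ^ 2).toNat - 1) := by
    refine ((summable_toNat_sq_pow_mul_pow hρ0.le hρ1 1).mul_left ρ⁻¹).congr fun r => ?_
    rcases Nat.eq_zero_or_pos (r ^ 2).toNat with h | h
    · simp [h]
    · rw [← Nat.sub_add_cancel h, pow_succ ρ, Nat.add_sub_cancel]; field_simp
  refine hasDerivAt_tsum_of_isPreconnected (t := Ioo 0 ρ) (y₀ := z)
    (g := fun (r : ℤ) (y : ℝ) => y ^ (r ^ 2).toNat)
    (g' := fun (r : ℤ) (y : ℝ) => ((r ^ 2).toNat : ℝ) * y ^ ((r ^ 2).toNat - 1))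
    hu isOpen_Ioo isPreconnected_Ioo (fun r y _ => hasDerivAt_pow _ _) (fun r y hy => ?_)
    ⟨hz.1, hzρ⟩ ?_ ⟨hz.1, hzρ⟩
  · have := hy.1.le
    have := hy.2.le
    rw [Real.norm_of_nonneg (by positivity)]
    gcongr
  · simpa using summable_toNat_sq_pow_mul_pow hz.1.le hz.2 0

lemma hasSum_jacobiH {z : ℝ} (hz : z ∈ Ioo (0 : ℝ) 1) :
    HasSum (fun r : ℤ => z ^ (r ^ 2).toNat) (jacobiH z) := by
  have := summable_toNat_sq_pow_mul_pow hz.1.le hz.2 0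
  simp only [pow_zero, one_mul] at this
  exact this.hasSum

lemma jacobiH_pos {z : ℝ} (hz : z ∈ Ioo (0 : ℝ) 1) : 0 < jacobiH z :=
  (hasSum_jacobiH hz).summable.tsum_pos (fun _ => pow_nonneg hz.1.le _) 0 (by simp)

/-- At a critical point of `l_γ` the tilted law of `r²` has mean `γ`. -/
lemma hasSum_sq_mul_pow_of_deriv_lgam_eq_zero {γ z : ℝ} (hz : z ∈ Ioo (0 : ℝ) 1)
    (h : deriv (lgam γ) z = 0) :
    HasSum (fun r : ℤ => (r : ℝ) ^ 2 * z ^ (r ^ 2).toNat) (γ * jacobiH z) := by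
  have hd := hasDerivAt_jacobiH hz
  have hH := jacobiH_pos hz
  have hl : HasDerivAt (lgam γ) _ z :=
    (hd.log hH.ne').sub ((Real.hasDerivAt_log hz.1.ne').const_mul γ)
  have heq := hl.deriv.symm.trans h
  have hs := summable_toNat_sq_pow_mul_pow hz.1.le hz.2 1
  simp only [pow_one] at hs
  have hmul : z * ∑' r : ℤ, ((r ^ 2).toNat : ℝ) * z ^ ((r ^ 2).toNat - 1)
      = ∑' r : ℤ, ((r ^ 2).toNat : ℝ) * z ^ (r ^ 2).toNat := by
    rw [← tsum_mul_left]
    refine tsum_congr fun r => ?_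
    rcases Nat.eq_zero_or_pos (r ^ 2).toNat with h | h
    · simp [h]
    · conv_rhs => rw [← Nat.sub_add_cancel h, pow_succ z, Nat.sub_add_cancel h]
      ring
  have hval : ∑' r : ℤ, ((r ^ 2).toNat : ℝ) * z ^ (r ^ 2).toNat = γ * jacobiH z := by
    rw [← hmul]
    have hz' := hz.1.ne'
    have hH' := hH.ne'
    field_simp at heq
    linarith
  have := hs.hasSum
  rw [hval] at this
  simpa only [cast_toNat_sq] using this

/-- The number of `k ∈ ℤⁿ` with `k₁² + … + k_n² ≤ s`. -/
noncomputable def latticeCount (n : ℕ) (s : ℤ) : ℕ :=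
  Set.ncard {k : Fin n → ℤ | ∑ i, k i ^ 2 ≤ s}

lemma finite_sum_sq_le (n : ℕ) (s : ℤ) : {k : Fin n → ℤ | ∑ i, k i ^ 2 ≤ s}.Finite := by
  refine (Set.finite_Icc (fun _ : Fin n => -s) (fun _ => s)).subset fun k hk => ?_
  have h : ∀ i, |k i| ≤ s := fun i => by
    have h1 : k i ^ 2 ≤ ∑ i, k i ^ 2 :=
      Finset.single_le_sum (f := fun i => k i ^ 2) (fun i _ => sq_nonneg _) (Finset.mem_univ i)
    have h2 : |k i| ≤ k i ^ 2 := by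
      rw [← sq_abs]; exact Int.le_self_sq _
    exact h2.trans (h1.trans hk)
  exact ⟨fun i => (abs_le.1 (h i)).1, fun i => (abs_le.1 (h i)).2⟩

lemma hasSum_indicator_one_ncard {α : Type*} {S : Set α} (hS : S.Finite) :
    HasSum (S.indicator fun _ => (1 : ℂ)) (S.ncard : ℂ) := by
  classical
  have h := hasSum_sum_of_ne_finset_zero (f := S.indicator fun _ => (1 : ℂ)) (s := hS.toFinset)
    (L := SummationFilter.unconditional α) (by intro b hb; simpa using hb)
  convert! h
  rw [Finset.sum_congr rfl fun b hb => indicator_of_mem (hS.mem_toFinset.1 hb) _,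
    Set.ncard_eq_toFinset_card S hS]
  simp

lemma hasSum_latticeCount_sub_sq (n : ℕ) (s : ℤ) :
    HasSum (fun j : ℤ => (latticeCount n (s - j ^ 2) : ℂ)) (latticeCount (n + 1) s) := by
  have h := hasSum_indicator_one_ncard (finite_sum_sq_le (n + 1) s)
  rw [← (Fin.consEquiv fun _ : Fin (n + 1) => ℤ).hasSum_iff] at h
  refine h.prod_fiberwise fun j => ?_
  convert! hasSum_indicator_one_ncard (finite_sum_sq_le n (s - j ^ 2)) using 2 with k
  simp only [Function.comp, Set.indicator, Set.mem_ofPred_eq, Fin.consEquiv_apply,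
    Fin.sum_univ_succ, Fin.cons_zero, Fin.cons_succ]
  congr 1
  exact propext ⟨fun h => by linarith, fun h => by linarith⟩

lemma latticeCount_zero (s : ℤ) : latticeCount 0 s = if 0 ≤ s then 1 else 0 := by
  by_cases h : 0 ≤ s
  · simp [latticeCount, h, Set.ncard_univ]
  · simp [latticeCount, h]

lemma integral_exp_int_mul_I (k : ℤ) :
    ∫ θ in (-π)..π, Complex.exp ((k * θ : ℝ) * Complex.I) = if k = 0 then (2 * π : ℂ) else 0 := by
  split_ifs with hk
  · subst hk
    simp
    ring
  · have hc : (k : ℂ) * Complex.I ≠ 0 := mul_ne_zero (by exact_mod_cast hk) Complex.I_ne_zero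
    have h := integral_exp_mul_complex (a := -π) (b := π) hc
    have he : Complex.exp (k * Complex.I * (π : ℝ)) = Complex.exp (k * Complex.I * (-π : ℝ)) := by
      rw [Complex.exp_eq_exp_iff_exists_int]
      exact ⟨k, by push_cast; ring⟩
    rw [he, sub_self, zero_div] at h
    rw [← h]
    refine intervalIntegral.integral_congr fun θ _ => ?_
    congr 1
    push_cast
    ring

lemma one_sub_mul_exp_ne_zero {z : ℝ} (hz : z ∈ Ioo (0 : ℝ) 1) (θ : ℝ) :
    1 - (z : ℂ) * Complex.exp (θ * Complex.I) ≠ 0 := by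
  intro h
  have := congrArg norm (sub_eq_zero.1 h)
  rw [norm_weight_mul_exp hz.1.le, norm_one] at this
  exact hz.2.ne this.symm

/-- The kernel `e^{-isθ} / (1 - z e^{iθ})` extracting partial sums of coefficients. -/
noncomputable def cumulativeKernel (z s θ : ℝ) : ℂ :=
  (1 - (z : ℂ) * Complex.exp (θ * Complex.I))⁻¹ * Complex.exp ((-s * θ : ℝ) * Complex.I)

lemma continuous_cumulativeKernel {z : ℝ} (hz : z ∈ Ioo (0 : ℝ) 1) (s : ℝ) :
    Continuous (cumulativeKernel z s) := by
  refine Continuous.mul (Continuous.inv₀ (by fun_prop) (one_sub_mul_exp_ne_zero hz)) ?_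
  fun_prop

lemma exp_mul_cumulativeKernel (z s t θ : ℝ) :
    Complex.exp ((t * θ : ℝ) * Complex.I) * cumulativeKernel z s θ
      = cumulativeKernel z (s - t) θ := by
  rw [cumulativeKernel, cumulativeKernel, mul_left_comm, ← Complex.exp_add]
  push_cast
  ring_nf

lemma integral_cumulativeKernel {z : ℝ} (hz : z ∈ Ioo (0 : ℝ) 1) (s : ℤ) :
    ∫ θ in (-π)..π, cumulativeKernel z s θ
      = if 0 ≤ s then 2 * π * (z : ℂ) ^ s else 0 := by
  have hgeo : Summable fun t : ℕ => z ^ t := summable_geometric_of_lt_one hz.1.le hz.2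
  have hsum : ∀ θ : ℝ, HasSum
      (fun t : ℕ => ((z ^ t : ℝ) : ℂ) * Complex.exp ((((t - s : ℤ) : ℝ) * θ : ℝ) * Complex.I))
      (cumulativeKernel z s θ) := by
    intro θ
    have h := (hasSum_geometric_of_norm_lt_one
      (ξ := (z : ℂ) * Complex.exp (θ * Complex.I))
      (by rw [norm_weight_mul_exp hz.1.le]; exact hz.2)).mul_right
      (Complex.exp ((-s * θ : ℝ) * Complex.I))
    convert! h using 2 with t
    rw [mul_pow, ← Complex.exp_nat_mul, mul_assoc, ← Complex.exp_add]
    push_cast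
    ring_nf
  have h := intervalIntegral.hasSum_integral_of_dominated_convergence
    (μ := MeasureTheory.volume) (a := -π) (b := π)
    (F := fun (t : ℕ) (θ : ℝ) =>
      ((z ^ t : ℝ) : ℂ) * Complex.exp ((((t - s : ℤ) : ℝ) * θ : ℝ) * Complex.I))
    (f := cumulativeKernel z s) (fun t _ => z ^ t)
    (fun t => Continuous.aestronglyMeasurable (by fun_prop))
    (fun t => Eventually.of_forall fun θ _ => (norm_weight_mul_exp (pow_nonneg hz.1.le t) _).le)
    (Eventually.of_forall fun _ _ => hgeo) intervalIntegrable_const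
    (Eventually.of_forall fun θ _ => hsum θ)
  simp only [intervalIntegral.integral_const_mul, integral_exp_int_mul_I] at h
  refine h.unique ?_
  split_ifs with hs
  · obtain ⟨m, rfl⟩ := Int.eq_ofNat_of_zero_le hs
    convert! hasSum_single (f := fun t : ℕ => ((z ^ t : ℝ) : ℂ) *
      if (t : ℤ) - (m : ℤ) = 0 then (2 * π : ℂ) else 0) m ?_ using 1
    · simp [mul_comm]
    · intro t ht
      rw [if_neg (by omega), mul_zero]
  · convert! hasSum_zero using 2 with t
    rw [if_neg (by omega), mul_zero]

/-- Cauchy's formula for the number of lattice points in a ball. -/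
lemma integral_trigSeries_pow_mul_cumulativeKernel {z : ℝ} (hz : z ∈ Ioo (0 : ℝ) 1) (n : ℕ) :
    ∀ s : ℤ, ∫ θ in (-π)..π,
      trigSeries (fun r : ℤ => z ^ (r ^ 2).toNat) (fun r => (r : ℝ) ^ 2) θ ^ n
        * cumulativeKernel z s θ = 2 * π * (z : ℂ) ^ s * latticeCount n s := by
  have hq0 : ∀ r : ℤ, 0 ≤ z ^ (r ^ 2).toNat := fun r => pow_nonneg hz.1.le _
  have hq := (hasSum_jacobiH hz).summable
  have hzC : (z : ℂ) ≠ 0 := by exact_mod_cast hz.1.ne'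
  have hcont := continuous_trigSeries hq0 hq (fun r => (r : ℝ) ^ 2)
  induction n with
  | zero =>
    intro s
    simp only [pow_zero, one_mul, integral_cumulativeKernel hz, latticeCount_zero]
    split_ifs <;> simp
  | succ n ih =>
    intro s
    set T := trigSeries (fun r : ℤ => z ^ (r ^ 2).toNat) (fun r => (r : ℝ) ^ 2) with hT
    have hW := continuous_cumulativeKernel hz s
    have h := intervalIntegral.hasSum_integral_of_dominated_convergence
      (μ := MeasureTheory.volume) (a := -π) (b := π)
      (F := fun (r : ℤ) (θ : ℝ) => ((z ^ (r ^ 2).toNat : ℝ) : ℂ) *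
        Complex.exp (((r : ℝ) ^ 2 * θ : ℝ) * Complex.I) * (T θ ^ n * cumulativeKernel z s θ))
      (f := fun θ => T θ * (T θ ^ n * cumulativeKernel z s θ))
      (fun r θ => z ^ (r ^ 2).toNat * ‖T θ ^ n * cumulativeKernel z s θ‖)
      (fun r => Continuous.aestronglyMeasurable (by fun_prop))
      (fun r => Eventually.of_forall fun θ _ => by
        rw [norm_mul, norm_weight_mul_exp (hq0 r)])
      (Eventually.of_forall fun θ _ => hq.mul_right _)
      (by
        simp_rw [tsum_mul_right]
        exact Continuous.intervalIntegrable (by fun_prop) _ _)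
      (Eventually.of_forall fun θ _ =>
        ((summable_weight_mul_exp hq0 hq fun r => (r : ℝ) ^ 2 * θ).hasSum).mul_right _)
    simp only [pow_succ' (T _), mul_assoc] at h ⊢
    refine h.unique ?_
    convert! (hasSum_latticeCount_sub_sq n s).mul_left (2 * π * (z : ℂ) ^ s) using 1
    · funext r
      rw [intervalIntegral.integral_const_mul]
      have hz2 : (z : ℂ) ^ s = (z : ℂ) ^ (r ^ 2).toNat * (z : ℂ) ^ (s - r ^ 2) := by
        rw [← zpow_natCast, Int.toNat_of_nonneg (sq_nonneg r), ← zpow_add₀ hzC]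
        congr 1; ring
      have hi := ih (s - r ^ 2)
      push_cast at hi
      simp_rw [mul_left_comm _ (T _ ^ n), exp_mul_cumulativeKernel, hi, hz2]
      push_cast
      ring
    · ring

lemma N1_eq_latticeCount {d : ℕ} {γ : ℝ} {m : ℤ} (hm : γ * d = m) :
    N1 d γ = latticeCount d m := by
  simp only [N1, latticeCount, hm]
  congr 1
  ext k
  simp only [Set.mem_ofPred_eq]
  exact_mod_cast Iff.rfl

lemma N2_eq_latticeCount {n : ℕ} {γ : ℝ} {m : ℤ} (hm : γ * (n + 1 : ℕ) = m) :
    N2 (n + 1) γ = latticeCount n m := by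
  have hinj : Function.Injective fun k : Fin n → ℤ => (Fin.cons 0 k : Fin (n + 1) → ℤ) :=
    Fin.cons_right_injective (α := fun _ => ℤ) 0
  rw [N2, latticeCount, ← Set.ncard_image_of_injective _ hinj, hm]
  congr 1
  ext k
  simp only [Set.mem_ofPred_eq, Set.mem_image]
  constructor
  · rintro ⟨h0, hk⟩
    have hk0 : k 0 = 0 := h0 0 rfl
    refine ⟨Fin.tail k, ?_, by rw [← hk0]; exact Fin.cons_self_tail k⟩
    rw [Fin.sum_univ_succ, hk0] at hk
    simp only [Int.cast_zero, ne_eq, OfNat.ofNat_ne_zero, not_false_eq_true, zero_pow,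
      zero_add] at hk
    exact_mod_cast hk
  · rintro ⟨k, hk, rfl⟩
    refine ⟨fun i hi => ?_, ?_⟩
    · rw [show i = 0 from Fin.ext hi]
      exact Fin.cons_zero _ _
    · simp only [Fin.sum_univ_succ, Fin.cons_zero, Fin.cons_succ, Int.cast_zero, ne_eq,
        OfNat.ofNat_ne_zero, not_false_eq_true, zero_pow, zero_add]
      exact_mod_cast hk

/-- Tilting and centring: the theta series on a circle as a multiple of a characteristic
function. -/
lemma trigSeries_eq_mul_exp_mul_trigSeries {ι : Type*} (q x : ι → ℝ) {h : ℝ} (hh : h ≠ 0)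
    (γ θ : ℝ) :
    trigSeries q x θ = h * Complex.exp ((γ * θ : ℝ) * Complex.I)
      * trigSeries (fun r => q r / h) (fun r => x r - γ) θ := by
  have hhC : (h : ℂ) ≠ 0 := by exact_mod_cast hh
  rw [trigSeries, trigSeries, ← tsum_mul_left]
  refine tsum_congr fun r => ?_
  rw [show x r * θ = γ * θ + (x r - γ) * θ by ring, Complex.ofReal_add, add_mul, Complex.exp_add,
    Complex.ofReal_div]
  field_simp

lemma trigSeries_pow_mul_cumulativeKernel {ι : Type*} (q x : ι → ℝ) {h : ℝ} (hh : h ≠ 0)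
    (γ z s θ : ℝ) (n : ℕ) :
    trigSeries q x θ ^ n * cumulativeKernel z s θ
      = (h : ℂ) ^ n * (trigSeries (fun r => q r / h) (fun r => x r - γ) θ ^ n
        * cumulativeKernel z (s - n * γ) θ) := by
  have he : Complex.exp ((γ * θ : ℝ) * Complex.I) ^ n
      = Complex.exp ((n * γ * θ : ℝ) * Complex.I) := by
    rw [← Complex.exp_nat_mul]
    push_cast
    ring_nf
  rw [trigSeries_eq_mul_exp_mul_trigSeries q x hh γ, ← exp_mul_cumulativeKernel z s (n * γ),
    mul_pow, mul_pow, he]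
  ring

/-- When `γ(n+1)` is an integer, the ratio of counts is a ratio of integrals of powers of the
tilted characteristic function. -/
lemma N1_div_N2_eq_integral_div {γ z : ℝ} (hz : z ∈ Ioo (0 : ℝ) 1) {n : ℕ} {m : ℤ}
    (hm : γ * (n + 1 : ℕ) = m) :
    let ψ := trigSeries (fun r : ℤ => z ^ (r ^ 2).toNat / jacobiH z) (fun r => (r : ℝ) ^ 2 - γ)
    (((N1 (n + 1) γ : ℝ) / (N2 (n + 1) γ : ℝ) : ℝ) : ℂ)
      = jacobiH z * ((∫ θ in (-π)..π, ψ θ ^ n * (ψ θ * cumulativeKernel z 0 θ))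
        / ∫ θ in (-π)..π, ψ θ ^ n * cumulativeKernel z γ θ) := by
  intro ψ
  have hH := (jacobiH_pos hz).ne'
  have hHC : (jacobiH z : ℂ) ≠ 0 := by exact_mod_cast hH
  have hzC : (z : ℂ) ≠ 0 := by exact_mod_cast hz.1.ne'
  have hπC : (π : ℂ) ≠ 0 := by exact_mod_cast pi_ne_zero
  have h1 := integral_trigSeries_pow_mul_cumulativeKernel hz (n + 1) m
  have h2 := integral_trigSeries_pow_mul_cumulativeKernel hz n m
  rw [funext fun θ => trigSeries_pow_mul_cumulativeKernel _ _ hH γ z m θ _,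
    intervalIntegral.integral_const_mul] at h1 h2
  rw [show (m : ℝ) - ((n + 1 : ℕ) : ℝ) * γ = 0 by rw [← hm]; ring] at h1
  rw [show (m : ℝ) - (n : ℝ) * γ = γ by rw [← hm]; push_cast; ring] at h2
  simp only [pow_succ (trigSeries _ _ _), mul_assoc (trigSeries _ _ _ ^ n)] at h1
  have hzm : (2 * π * (z : ℂ) ^ m) ≠ 0 :=
    mul_ne_zero (mul_ne_zero two_ne_zero hπC) (zpow_ne_zero _ hzC)
  rw [N1_eq_latticeCount hm, N2_eq_latticeCount hm]
  push_cast
  rw [← mul_div_mul_left _ _ hzm, ← h1, ← h2, pow_succ, mul_assoc, mul_div_mul_left _ _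
    (pow_ne_zero n hHC), mul_div_assoc]

/-- For a positive rational `γ`, with `z_γ ∈ (0,1)` the unique root of
`l_γ'`, as `d → ∞` along integers with `γ d ∈ ℤ`, the ratio `N₁(d,γ)/N₂(d,γ)`
converges to `h(z_γ)`. -/
theorem N1_div_N2_tendsto_jacobiH (γ : ℚ) (hγ : 0 < γ) (zγ : ℝ)
    (hzγ : zγ ∈ Set.Ioo (0 : ℝ) 1 ∧ deriv (lgam (γ : ℝ)) zγ = 0)
    (huniq : ∀ z : ℝ, z ∈ Set.Ioo (0 : ℝ) 1 ∧ deriv (lgam (γ : ℝ)) z = 0 → z = zγ) :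
    Filter.Tendsto
      (fun d : ℕ => (N1 d (γ : ℝ) : ℝ) / (N2 d (γ : ℝ) : ℝ))
      (alongIntMultiples γ) (nhds (jacobiH zγ)) := by
  
  obtain ⟨hz, hd⟩ := hzγ
  set h := jacobiH zγ with hh
  have hpos : 0 < h := jacobiH_pos hz
  set p : ℤ → ℝ := fun r => zγ ^ (r ^ 2).toNat / h with hpdef
  set x : ℤ → ℝ := fun r => (r : ℝ) ^ 2 - γ with hxdef
  have hz0 := hz.1
  have hp : ∀ r, 0 < p r := fun r => by positivity
  have hsum := hasSum_jacobiH hz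
  have hmean := hasSum_sq_mul_pow_of_deriv_lgam_eq_zero hz hd
  have h0 : HasSum p 1 := by
    rw [← div_self hpos.ne']
    exact hsum.div_const h
  have h1 : HasSum (fun r => p r * x r) 0 := by
    convert! (hmean.sub (hsum.mul_left (γ : ℝ))).div_const h using 2
    · simp only [hpdef, hxdef]; ring
    · simp [hh]
  have h2 : Summable fun r => p r * x r ^ 2 := by
    have hs2 := summable_toNat_sq_pow_mul_pow hz.1.le hz.2 2
    simp only [cast_toNat_sq] at hs2
    refine (((hs2.sub (hmean.summable.mul_left (2 * (γ : ℝ)))).add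
      (hsum.summable.mul_left ((γ : ℝ) ^ 2))).div_const h).congr fun r => ?_
    simp only [hpdef, hxdef]; ring
  have hσ : 0 < ∑' r, p r * x r ^ 2 := by
    refine h2.tsum_pos (fun r => mul_nonneg (hp r).le (sq_nonneg _)) 0 (mul_pos (hp 0) ?_)
    have hγ' : (0 : ℝ) < γ := by exact_mod_cast hγ
    simp only [hxdef]
    push_cast
    nlinarith
  obtain ⟨c, hc, hbound⟩ := exists_norm_trigSeries_le_exp (x := x) (fun r => (hp r).le) h0 (hp 0)
    (hp 1) (by simp [hxdef]; ring)
  have hψ := continuous_trigSeries (fun r => (hp r).le) h0.summable x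
  have hψ0 : trigSeries p x 0 = 1 := by
    simp only [trigSeries, mul_zero, Complex.ofReal_zero, zero_mul, Complex.exp_zero, mul_one]
    rw [← Complex.ofReal_tsum, h0.tsum_eq, Complex.ofReal_one]
  have hK0 : cumulativeKernel zγ γ 0 = cumulativeKernel zγ 0 0 := by simp [cumulativeKernel]
  have hK0ne : cumulativeKernel zγ 0 0 ≠ 0 :=
    mul_ne_zero (inv_ne_zero (one_sub_mul_exp_ne_zero hz 0)) (Complex.exp_ne_zero _)
  have hC : (∫ u : ℝ, Complex.exp ((-((∑' r, p r * x r ^ 2) / 2) * u ^ 2 : ℝ))) ≠ 0 := by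
    simp_rw [← Complex.ofReal_exp]
    rw [integral_complex_ofReal, integral_gaussian]
    exact_mod_cast (Real.sqrt_pos.2 (by positivity)).ne'
  have hI₁ := tendsto_sqrt_mul_integral_trigSeries_pow (fun r => (hp r).le) h0 h1 h2 hc hbound
    (hψ.mul (continuous_cumulativeKernel hz 0))
  have hI₂ := tendsto_sqrt_mul_integral_trigSeries_pow (fun r => (hp r).le) h0 h1 h2 hc hbound
    (continuous_cumulativeKernel hz γ)
  simp only [Pi.mul_apply] at hI₁
  rw [hψ0, one_mul] at hI₁
  rw [hK0] at hI₂
  have hratio := ((hI₁.div hI₂ (mul_ne_zero hC hK0ne)).const_mul (h : ℂ)).comp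
    (tendsto_sub_atTop_nat 1)
  rw [div_self (mul_ne_zero hC hK0ne), mul_one] at hratio
  have hre := (Complex.continuous_re.tendsto _).comp (hratio.mono_left
    (inf_le_left : alongIntMultiples γ ≤ atTop))
  rw [Complex.ofReal_re] at hre
  refine hre.congr' ?_
  have hint : ∀ᶠ d : ℕ in alongIntMultiples γ, ∃ m : ℤ, (γ : ℝ) * d = m :=
    Filter.mem_inf_of_right (mem_principal_self _)
  have hlarge : ∀ᶠ d in alongIntMultiples γ, 2 ≤ d :=
    (eventually_ge_atTop 2).filter_mono inf_le_left
  filter_upwards [hint, hlarge] with d hdm hd2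
  obtain ⟨m, hm⟩ := hdm
  obtain ⟨n, rfl⟩ : ∃ n, d = n + 1 := ⟨d - 1, by omega⟩
  have hn : ((√(n : ℝ) : ℝ) : ℂ) ≠ 0 := by
    exact_mod_cast (Real.sqrt_pos.2 (by exact_mod_cast (by omega : 0 < n))).ne'
  have heq := congrArg Complex.re (N1_div_N2_eq_integral_div hz hm)
  rw [Complex.ofReal_re] at heq
  simp only [Function.comp_apply, Nat.add_sub_cancel, Pi.div_apply]
  rw [mul_div_mul_left _ _ hn, heq]
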